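/- Let f : [m,M] → ℝ be a convex function that is monotone nonincreasing on [m,M], let x₁,…,xₙ, y₁,…,yₙ ∈ [m,M], and let p₁,…,pₙ be positive real numbers with ∑_{i=1}^n pᵢ = 1. Suppose ∑_{i=1}^n pᵢ xᵢ ≤ ∑_{i=1}^n pᵢ yᵢ. Then for any α ≥ 0 and any real β such that a_f t + b_f − α f(t) ≤ β for all t ∈ [m,M], one has ∑_{i=1}^n pᵢ f(yᵢ) ≤ β + α ∑_{i=1}^n pᵢ f(xᵢ). -/

import Mathlib

/-- A convex function on `[m, M]` lies below the chord through its endpoints. -/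
theorem ConvexOn.le_chord {m M : ℝ} (hmM : m < M) {f : ℝ → ℝ}
    (hconv : ConvexOn ℝ (Set.Icc m M) f) {t : ℝ} (ht : t ∈ Set.Icc m M) :
    f t ≤ ((f M - f m) / (M - m)) * t + (M * f m - m * f M) / (M - m) := by
  have hpos : 0 < M - m := sub_pos.2 hmM
  have h := hconv.2 (Set.left_mem_Icc.2 hmM.le) (Set.right_mem_Icc.2 hmM.le)
    (div_nonneg (sub_nonneg.2 ht.2) hpos.le) (div_nonneg (sub_nonneg.2 ht.1) hpos.le)
    (by field_simp; ring)
  simp only [smul_eq_mul] at h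
  have ht' : (M - t) / (M - m) * m + (t - m) / (M - m) * M = t := by
    field_simp
    ring
  rw [ht'] at h
  refine h.trans_eq ?_
  field_simp
  ring

theorem stmt6 (m M : ℝ) (hmM : m < M) (f : ℝ → ℝ)
    (hconv : ConvexOn ℝ (Set.Icc m M) f)
    (hmono : AntitoneOn f (Set.Icc m M))
    (n : ℕ) (x y : Fin n → ℝ)
    (hx : ∀ i, x i ∈ Set.Icc m M) (hy : ∀ i, y i ∈ Set.Icc m M)
    (p : Fin n → ℝ) (hp : ∀ i, 0 < p i) (hp1 : ∑ i, p i = 1)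
    (hle : ∑ i, p i * x i ≤ ∑ i, p i * y i)
    (α : ℝ) (hα : 0 ≤ α) (β : ℝ)
    (hβ : ∀ t ∈ Set.Icc m M,
      ((f M - f m) / (M - m)) * t + (M * f m - m * f M) / (M - m) - α * f t ≤ β) :
    ∑ i, p i * f (y i) ≤ β + α * ∑ i, p i * f (x i) := by
  have hchord := fun t ht => hconv.le_chord hmM (t := t) ht
  have hslope : (f M - f m) / (M - m) ≤ 0 :=
    div_nonpos_of_nonpos_of_nonneg
      (sub_nonpos.2 (hmono (Set.left_mem_Icc.2 hmM.le) (Set.right_mem_Icc.2 hmM.le) hmM.le))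
      (sub_nonneg.2 hmM.le)
  generalize (f M - f m) / (M - m) = a at *
  generalize (M * f m - m * f M) / (M - m) = b at *
  have hsum : ∀ (c d : ℝ) (z : Fin n → ℝ),
      ∑ i, p i * (c * z i + d) = c * ∑ i, p i * z i + d := by
    intro c d z
    simp only [mul_add, Finset.sum_add_distrib, ← Finset.sum_mul, hp1, one_mul, Finset.mul_sum,
      mul_left_comm]
  calc ∑ i, p i * f (y i) ≤ ∑ i, p i * (a * y i + b) :=
        Finset.sum_le_sum fun i _ => mul_le_mul_of_nonneg_left (hchord _ (hy i)) (hp i).le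
    _ = a * ∑ i, p i * y i + b := hsum a b y
    _ ≤ a * ∑ i, p i * x i + b := by
        linarith [mul_le_mul_of_nonpos_left hle hslope]
    _ = ∑ i, p i * (a * x i + b) := (hsum a b x).symm
    _ ≤ ∑ i, p i * (α * f (x i) + β) :=
        Finset.sum_le_sum fun i _ =>
          mul_le_mul_of_nonneg_left (by linarith [hβ _ (hx i)]) (hp i).le
    _ = β + α * ∑ i, p i * f (x i) := by
        rw [hsum α β fun i => f (x i), add_comm]
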